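/- Let m, r be positive integers and p a natural number with p ≥ r·m. Then S_r(p,m) ≤ (p! · m^{p−rm} / (m! · (r!)^m · (p−rm)! · (r+1)^{p−rm})) · (1 + ((r+1)^{p−rm} − 1 − r(p−rm)) / (m·r·(r+2))). -/

import Mathlib

/-- `stirlingAssoc r p m` is the `r`-associated Stirling number of the second kind:
the number of partitions of `{1,…,p}` into exactly `m` parts, each of size at least `r`. -/
noncomputable def stirlingAssoc (r p m : ℕ) : ℕ :=
  Nat.card {P : Finpartition (Finset.univ : Finset (Fin p)) //
    P.parts.card = m ∧ ∀ s ∈ P.parts, r ≤ s.card}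

open Finset

/-- weights -/
noncomputable def cc (r k : ℕ) : ℝ := (r.factorial * k.factorial * (r+1)^k : ℝ) / (r+k).factorial

lemma cc_zero (r : ℕ) : cc r 0 = 1 := by
  unfold cc; simp [Nat.factorial_ne_zero]

lemma cc_pos (r k : ℕ) : 0 < cc r k := by
  unfold cc; positivity

lemma cc_succ (r k : ℕ) : cc r (k+1) = cc r k * ((r+1)*(k+1)/(r+k+1)) := by
  unfold cc
  rw [show r + (k+1) = (r+k)+1 by ring, Nat.factorial_succ, Nat.factorial_succ]
  push_cast
  have : (r+k+1:ℝ) ≠ 0 := by positivity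
  field_simp
  ring

lemma cc_succ' (r k : ℕ) : cc r (k+1) = cc r k * (1 + r*k/(r+k+1)) := by
  rw [cc_succ]
  have : (r+k+1:ℝ) ≠ 0 := by positivity
  field_simp
  ring

lemma cc_mul (r a b : ℕ) : cc r a * cc r b ≤ cc r (a+b) := by
  induction b with
  | zero => simp [cc_zero]
  | succ b ih =>
    rw [← add_assoc, cc_succ', cc_succ']
    calc cc r a * (cc r b * (1 + r*b/(r+b+1))) = (cc r a * cc r b) * (1 + r*b/(r+b+1)) := by ring
      _ ≤ cc r (a+b) * (1 + r*b/(r+b+1)) := by gcongr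
      _ ≤ _ := by
        have := (cc_pos r (a+b)).le
        gcongr cc r (a+b) * (1 + ?_)
        rw [div_le_div_iff₀ (by positivity) (by positivity)]
        push_cast
        have : (0:ℝ) ≤ r * a * (r+1) := by positivity
        nlinarith

lemma cc_prod {ι : Type*} (s : Finset ι) (r : ℕ) (k : ι → ℕ) :
    ∏ i ∈ s, cc r (k i) ≤ cc r (∑ i ∈ s, k i) := by
  classical
  induction s using Finset.induction_on with
  | empty => simp [cc_zero]
  | insert a s ha ih =>
    rw [Finset.prod_insert ha, Finset.sum_insert ha]
    refine le_trans ?_ (cc_mul r _ _)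
    have := (cc_pos r (k a)).le
    gcongr

lemma cc_bound (r n : ℕ) (hr : 0 < r) : r * n * cc r n ≤ ((r:ℝ)+1)^n - 1 := by
  rcases Nat.lt_or_ge 1 r with h | h
  · induction n with
    | zero => simp
    | succ n ih =>
      rcases Nat.eq_zero_or_pos n with rfl | hn
      · simp [cc_succ', cc_zero]
      · have h1 : (2:ℝ) ≤ r := by exact_mod_cast h
        have h2 : (1:ℝ) ≤ n := by exact_mod_cast hn
        have h3 : (r * (n+1:ℕ) * cc r (n+1) : ℝ) ≤ (r+1) * (r * n * cc r n) := by
          rw [cc_succ]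
          have : (r * (n+1:ℕ) * (cc r n * ((r+1)*(n+1)/(r+n+1))) : ℝ) = (r * (r+1) * cc r n) * ((n+1)*(n+1)/(r+n+1)) := by
            push_cast; field_simp
          rw [this]
          have : ((r+1) * (r * n * cc r n) : ℝ) = (r * (r+1) * cc r n) * n := by ring
          rw [this]
          have := (cc_pos r n).le
          gcongr
          rw [div_le_iff₀ (by positivity)]
          nlinarith
        rw [pow_succ]
        nlinarith
  · obtain rfl : r = 1 := by omega
    have h1 : cc 1 n = 2^n/(n+1) := by
      unfold cc
      rw [add_comm 1 n, Nat.factorial_succ n]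
      push_cast
      rw [div_eq_div_iff (by positivity) (by positivity)]
      norm_num
      ring
    have h2 : (n+1:ℝ) ≤ 2^n := by exact_mod_cast Nat.lt_two_pow_self
    rw [h1]
    norm_num
    have : (n:ℝ) * (2^n/(n+1)) = 2^n - 2^n/(n+1) := by field_simp; ring
    rw [this]
    have : 1 ≤ (2:ℝ)^n/(n+1) := by rw [le_div_iff₀ (by positivity)]; linarith
    linarith

/-- fibre size -/
def fib {n m : ℕ} (g : Fin n → Fin m) (i : Fin m) : ℕ := #{a | g a = i}

lemma fib_sum {n m : ℕ} (g : Fin n → Fin m) : ∑ i, fib g i = n := by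
  unfold fib
  rw [← Finset.card_eq_sum_card_fiberwise (by simp)]
  simp

lemma fib_cons {n m : ℕ} (g : Fin n → Fin m) (j i : Fin m) :
    fib (Fin.cons j g : Fin (n+1) → Fin m) i = fib g i + if i = j then 1 else 0 := by
  unfold fib
  rw [Fin.card_filter_univ_succ]
  simp only [Fin.cons_zero, Fin.cons_succ]
  by_cases h : i = j
  · simp [h]
  · simp [h, Ne.symm h]

/-- weighted sum -/
noncomputable def HH {m : ℕ} (n : ℕ) (φ : Fin m → ℕ → ℝ) : ℝ :=
  ∑ g : Fin n → Fin m, ∏ i, φ i (fib g i)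

lemma HH_succ {m : ℕ} (n : ℕ) (φ : Fin m → ℕ → ℝ) :
    HH (n+1) φ = ∑ j, ∑ g : Fin n → Fin m, ∏ i, φ i (fib g i + if i = j then 1 else 0) := by
  unfold HH
  rw [← (Fin.consEquiv (fun _ : Fin (n+1) => Fin m)).sum_comp, Fintype.sum_prod_type]
  refine Finset.sum_congr rfl fun j _ => Finset.sum_congr rfl fun g _ =>
    Finset.prod_congr rfl fun i _ => ?_
  exact congrArg (φ i) (fib_cons g j i)

/-- egf -/
noncomputable def egf (φ : ℕ → ℝ) : PowerSeries ℝ := PowerSeries.mk fun k => φ k / k.factorial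

lemma egf_deriv (φ : ℕ → ℝ) :
    PowerSeries.derivative ℝ (egf φ) = egf (fun k => φ (k+1)) := by
  ext k
  rw [PowerSeries.coeff_derivative]
  simp only [egf, PowerSeries.coeff_mk, Nat.factorial_succ]
  push_cast
  field_simp

lemma deriv_prod {ι : Type*} [DecidableEq ι] (s : Finset ι) (f : ι → PowerSeries ℝ) :
    PowerSeries.derivative ℝ (∏ i ∈ s, f i) =
      ∑ j ∈ s, PowerSeries.derivative ℝ (f j) * ∏ i ∈ s.erase j, f i := by
  induction s using Finset.induction_on with
  | empty => simp
  | insert a s ha ih =>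
    rw [Finset.prod_insert ha, Finset.sum_insert ha, Derivation.leibniz, ih, Finset.erase_insert ha,
      smul_eq_mul, smul_eq_mul, add_comm, mul_comm (∏ i ∈ s, f i), Finset.mul_sum]
    congr 1
    refine Finset.sum_congr rfl fun j hj => ?_
    have hne : a ≠ j := fun h => ha (h ▸ hj)
    rw [Finset.erase_insert_of_ne hne, Finset.prod_insert (by simp [ha])]
    ring

lemma HH_egf {m : ℕ} (n : ℕ) (φ : Fin m → ℕ → ℝ) :
    HH n φ = n.factorial * PowerSeries.coeff n (∏ i, egf (φ i)) := by
  induction n generalizing φ with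
  | zero =>
    simp [HH, fib, egf, map_prod]
  | succ n ih =>
    have h := PowerSeries.coeff_derivative (∏ i, egf (φ i)) n
    rw [deriv_prod] at h
    rw [HH_succ, Nat.factorial_succ]
    push_cast
    rw [show ((n:ℝ)+1) * n.factorial * PowerSeries.coeff (n+1) (∏ i, egf (φ i)) = n.factorial * (PowerSeries.coeff (n+1) (∏ i, egf (φ i)) * (n+1)) by ring, ← h, map_sum, Finset.mul_sum]
    refine Finset.sum_congr rfl fun j _ => ?_
    have := ih (fun i k => φ i (k + if i = j then 1 else 0))
    unfold HH at this
    rw [this, egf_deriv, ← Finset.mul_prod_erase _ _ (mem_univ j)]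
    simp only [if_true]
    congr 3
    refine Finset.prod_congr rfl fun i hi => ?_
    simp [Finset.ne_of_mem_erase hi]

lemma TT_le (r m n : ℕ) : HH n (fun _ : Fin m => cc r) ≤ m^n * cc r n := by
  unfold HH
  calc _ ≤ ∑ g : Fin n → Fin m, cc r n := by
        refine Finset.sum_le_sum fun g _ => ?_
        refine (cc_prod univ r (fib g)).trans_eq ?_
        rw [fib_sum]
    _ = _ := by simp

lemma TT_succ (r m n : ℕ) : HH (n+1) (fun _ : Fin m => cc r) ≤
    (m + r * n / (r+2)) * HH n (fun _ : Fin m => cc r) := by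
  rw [HH_succ, Finset.sum_comm]
  unfold HH
  rw [Finset.mul_sum]
  refine Finset.sum_le_sum fun g _ => ?_
  have hP : 0 ≤ ∏ i, cc r (fib g i) := Finset.prod_nonneg fun i _ => (cc_pos _ _).le
  calc _ ≤ ∑ j : Fin m, (1 + r * fib g j / (r+2)) * ∏ i, cc r (fib g i) := by
        refine Finset.sum_le_sum fun j _ => ?_
        rw [← Finset.mul_prod_erase _ _ (mem_univ j)]
        rw [← Finset.mul_prod_erase univ (fun i => cc r (fib g i)) (mem_univ j)]
        have : ∏ x ∈ univ.erase j, cc r (fib g x + if x = j then 1 else 0) = ∏ x ∈ univ.erase j, cc r (fib g x) :=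
          Finset.prod_congr rfl fun i hi => by simp [Finset.ne_of_mem_erase hi]
        rw [this]
        simp only [if_true]
        rw [cc_succ', ← mul_assoc]
        have h0 : 0 ≤ ∏ x ∈ univ.erase j, cc r (fib g x) := Finset.prod_nonneg fun i _ => (cc_pos _ _).le
        have h1 := (cc_pos r (fib g j)).le
        rw [mul_comm (cc r _)]
        refine mul_le_mul_of_nonneg_right (mul_le_mul_of_nonneg_right ?_ h1) h0
        rcases Nat.eq_zero_or_pos (fib g j) with h | h
        · simp [h]
        · have : (1:ℝ) ≤ fib g j := by exact_mod_cast h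
          refine add_le_add le_rfl (div_le_div_of_nonneg_left (by positivity) (by positivity) ?_)
          linarith
    _ = _ := by
        rw [← Finset.sum_mul, Finset.sum_add_distrib, ← Finset.sum_div, ← Finset.mul_sum]
        rw [← Nat.cast_sum, fib_sum]
        simp

lemma TT_bound (r m n : ℕ) (hr : 0 < r) (hm : 0 < m) : HH n (fun _ : Fin m => cc r) ≤
    m^n * (1 + (((r:ℝ)+1)^n - 1 - r * n) / (m * r * (r+2))) := by
  have hr' : (0:ℝ) < r := by exact_mod_cast hr
  have hm' : (0:ℝ) < m := by exact_mod_cast hm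
  induction n with
  | zero => simp [HH, fib, cc_zero]
  | succ n ih =>
    have h1 := TT_succ r m n
    have h2 := TT_le r m n
    have h3 := cc_bound r n hr
    have h4 : r * n / (r+2) * HH n (fun _ : Fin m => cc r) ≤ m^n * ((((r:ℝ)+1)^n - 1)/(r+2)) := by
      calc r * n / (r+2) * HH n (fun _ : Fin m => cc r) ≤ r * n / (r+2) * (m^n * cc r n) := by gcongr
        _ = m^n * ((r * n * cc r n)/(r+2)) := by ring
        _ ≤ _ := by gcongr
    calc _ ≤ _ := h1
      _ = m * HH n (fun _ : Fin m => cc r) + r * n / (r+2) * HH n (fun _ : Fin m => cc r) := by ring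
      _ ≤ m * (m^n * (1 + (((r:ℝ)+1)^n - 1 - r * n) / (m * r * (r+2)))) + m^n * ((((r:ℝ)+1)^n - 1)/(r+2)) := by gcongr
      _ = _ := by
        push_cast
        field_simp
        ring

/-- indicator weights -/
noncomputable def ind (r k : ℕ) : ℝ := if r ≤ k then 1 else 0

lemma ind_egf (r : ℕ) : PowerSeries.C (r.factorial : ℝ) * egf (ind r) =
    PowerSeries.X ^ r * PowerSeries.rescale (1/((r:ℝ)+1)) (egf (cc r)) := by
  ext k
  rw [PowerSeries.coeff_C_mul, PowerSeries.coeff_X_pow_mul']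
  simp only [egf, PowerSeries.coeff_mk, PowerSeries.coeff_rescale, ind]
  split_ifs with h
  · obtain ⟨j, rfl⟩ := Nat.exists_eq_add_of_le h
    simp only [Nat.add_sub_cancel_left, cc]
    have h5 : (1/((r:ℝ)+1))^j * (r+1)^j = 1 := by
      rw [← mul_pow, one_div, inv_mul_cancel₀ (by positivity), one_pow]
    rw [show (1/((r:ℝ)+1))^j * ((r.factorial * j.factorial * (r+1)^j : ℝ) / (r+j).factorial / j.factorial) = ((1/((r:ℝ)+1))^j * (r+1)^j) * ((r.factorial * j.factorial : ℝ) / (r+j).factorial / j.factorial) by ring, h5]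
    field_simp
  · simp

lemma HH_ind (r m n : ℕ) : HH (r*m+n) (fun _ : Fin m => ind r) * ((r.factorial:ℝ)^m * n.factorial * ((r:ℝ)+1)^n) =
    (r*m+n).factorial * HH n (fun _ : Fin m => cc r) := by
  rw [HH_egf, HH_egf]
  simp only [Finset.prod_const, Finset.card_univ, Fintype.card_fin]
  have h := congrArg (fun x => PowerSeries.coeff (r*m+n) (x^m)) (ind_egf r)
  simp only [mul_pow] at h
  rw [← map_pow, ← map_pow, PowerSeries.coeff_C_mul, ← pow_mul, add_comm (r*m) n, PowerSeries.coeff_X_pow_mul,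
    PowerSeries.coeff_rescale] at h
  rw [add_comm (r*m) n]
  have h5 : (1/((r:ℝ)+1))^n * (r+1)^n = 1 := by
    rw [← mul_pow, one_div, inv_mul_cancel₀ (by positivity), one_pow]
  linear_combination ((n+r*m).factorial * n.factorial * ((r:ℝ)+1)^n) * h + ((n+r*m).factorial * n.factorial * PowerSeries.coeff n (egf (cc r) ^ m)) * h5

lemma part_count (r p m : ℕ) : (m.factorial * stirlingAssoc r p m : ℝ) ≤ HH p (fun _ : Fin m => ind r) := by
  classical
  have h1 : HH p (fun _ : Fin m => ind r) = Fintype.card {g : Fin p → Fin m // ∀ i, r ≤ fib g i} := by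
    rw [Fintype.card_subtype, Finset.card_filter]
    unfold HH ind
    push_cast
    refine Finset.sum_congr rfl fun g _ => ?_
    rw [Finset.prod_ite_zero]
    simp
  rw [h1]
  let Q := {P : Finpartition (Finset.univ : Finset (Fin p)) //
    P.parts.card = m ∧ ∀ s ∈ P.parts, r ≤ s.card}
  have h2 : Nat.card (Σ P : Q, (P.1.parts ≃ Fin m)) = m.factorial * stirlingAssoc r p m := by
    rw [Nat.card_sigma]
    have : ∀ P : Q, Nat.card (P.1.parts ≃ Fin m) = m.factorial := by
      intro P
      have e : P.1.parts ≃ Fin m := Finset.equivFinOfCardEq P.2.1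
      rw [Nat.card_eq_fintype_card, Fintype.card_equiv e]
      simp [P.2.1]
    simp only [this]
    simp [stirlingAssoc, Q, mul_comm]
  rw [← Nat.cast_mul, ← h2, ← Nat.card_eq_fintype_card, Nat.cast_le]
  let F : (Σ P : Q, (P.1.parts ≃ Fin m)) → (Fin p → Fin m) := fun x a =>
    x.2 ⟨x.1.1.part a, x.1.1.part_mem.2 (mem_univ a)⟩
  have hF : ∀ (x : Σ P : Q, (P.1.parts ≃ Fin m)) a b, F x a = F x b ↔ x.1.1.part a = x.1.1.part b := by
    intro x a b
    simp [F]
  refine Nat.card_le_card_of_injective (fun x => ⟨F x, ?_⟩) ?_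
  · intro i
    have h3 := x.1.2.2 _ (x.2.symm i).2
    refine h3.trans (Finset.card_le_card ?_)
    intro a ha
    simp only [mem_filter, mem_univ, true_and, F]
    rw [← Equiv.eq_symm_apply]
    ext1
    exact x.1.1.part_eq_of_mem (x.2.symm i).2 ha
  · intro x y hxy
    have hxy : F x = F y := congrArg Subtype.val hxy
    have hp : ∀ a, x.1.1.part a = y.1.1.part a := by
      intro a
      ext b
      have h3 := hF x b a
      have h4 := hF y b a
      rw [hxy] at h3
      rw [Finpartition.mem_part_iff_part_eq_part _ (mem_univ _) (mem_univ _),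
        Finpartition.mem_part_iff_part_eq_part _ (mem_univ _) (mem_univ _)]
      grind
    obtain ⟨P, σ⟩ := x
    obtain ⟨P', σ'⟩ := y
    have hPP : P = P' := by
      apply Subtype.ext
      apply Finpartition.ext
      ext s
      have key : ∀ (A B : Finpartition (Finset.univ : Finset (Fin p))), (∀ a, A.part a = B.part a) → s ∈ A.parts → s ∈ B.parts := by
        intro A B h hs
        obtain ⟨a, ha⟩ := A.nonempty_of_mem_parts hs
        rw [← A.part_eq_of_mem hs ha, h]
        exact B.part_mem.2 (mem_univ a)
      exact ⟨key _ _ hp, key _ _ fun a => (hp a).symm⟩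
    subst hPP
    congr 1
    ext1 s
    obtain ⟨a, ha⟩ := P.1.nonempty_of_mem_parts s.2
    have h5 := congrFun hxy a
    simp only [F] at h5
    have h6 : (⟨P.1.part a, P.1.part_mem.2 (mem_univ a)⟩ : P.1.parts) = s :=
      Subtype.ext (P.1.part_eq_of_mem s.2 ha)
    rwa [h6] at h5

theorem stmt_17 (m r : ℕ) (hm : 0 < m) (hr : 0 < r) (p : ℕ) (hp : r * m ≤ p) :
    (stirlingAssoc r p m : ℝ) ≤
      (p.factorial : ℝ) * (m : ℝ) ^ (p - r * m) /
          ((m.factorial : ℝ) * (r.factorial : ℝ) ^ m * ((p - r * m).factorial : ℝ) *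
            ((r : ℝ) + 1) ^ (p - r * m)) *
        (1 +
          (((r : ℝ) + 1) ^ (p - r * m) - 1 - (r : ℝ) * ((p : ℝ) - (r : ℝ) * m)) /
            ((m : ℝ) * r * ((r : ℝ) + 2))) := by
  obtain ⟨n, rfl⟩ := Nat.exists_eq_add_of_le hp
  have h1 := part_count r (r*m+n) m
  have h2 := HH_ind r m n
  have h3 := TT_bound r m n hr hm
  rw [Nat.add_sub_cancel_left]
  have h4 : ((r*m+n : ℕ):ℝ) - r * m = n := by push_cast; ring
  rw [h4, div_mul_eq_mul_div, le_div_iff₀ (by positivity)]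
  calc _ = (m.factorial * stirlingAssoc r (r*m+n) m : ℝ) * ((r.factorial:ℝ)^m * n.factorial * ((r:ℝ)+1)^n) := by ring
    _ ≤ HH (r*m+n) (fun _ : Fin m => ind r) * ((r.factorial:ℝ)^m * n.factorial * ((r:ℝ)+1)^n) := by gcongr
    _ = _ := h2
    _ ≤ (r*m+n).factorial * (m^n * (1 + (((r:ℝ)+1)^n - 1 - r * n) / (m * r * (r+2)))) := by gcongr
    _ = _ := by ring
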